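/- Let V be a doubled word with k distinct letters, Σ a finite alphabet with q ≥ 2 letters, and W_n ∈ Σ^n chosen uniformly at random. Then Var(δ(V,W_n)) = O((log n)^3 / n^3); consequently Var(δ(V,W_n)) = O(E(δ(V,W_n))^2 · (log n)^3 / n). -/

import Mathlib

open Filter Asymptotics

/-- The substring `W[i,j]` of `W`: the `j - i` consecutive letters of `W`
beginning with the `(i+1)`-th. -/
def subword {β : Type*} (W : List β) (i j : ℕ) : List β :=
  (W.drop i).take (j - i)

/-- `W` is an instance of `V` provided `W = φ(V)` for some nonerasing
homomorphism `φ`, i.e. a map on letters (no letter mapping to the empty word)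
extended by concatenation. -/
def IsInstance {α β : Type*} (V : List α) (W : List β) : Prop :=
  ∃ φ : α → List β, (∀ a, φ a ≠ []) ∧ W = (V.map φ).flatten

/-- A word is doubled provided every letter occurring in it occurs at least twice. -/
def Doubled {α : Type*} [DecidableEq α] (V : List α) : Prop :=
  ∀ a ∈ V, 2 ≤ V.count a

open Classical in
/-- `density V W` is the proportion of the `C(|W|+1, 2)` substrings of `W`
(indexed by pairs `(i,j)` with `0 ≤ i < j ≤ |W|`) that are instances of `V`. -/
noncomputable def density {α β : Type*} (V : List α) (W : List β) : ℝ :=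
  (((Finset.range (W.length + 1) ×ˢ Finset.range (W.length + 1)).filter
      (fun p => p.1 < p.2 ∧ IsInstance V (subword W p.1 p.2))).card : ℝ) /
    (Nat.choose (W.length + 1) 2)

/-- The expected density of `V` in a word of length `n` chosen uniformly at
random over the alphabet `σ` (words of length `n` being encoded as `Fin n → σ`). -/
noncomputable def expDensity {α : Type*} (V : List α) (σ : Type*) [Fintype σ] (n : ℕ) : ℝ :=
  (∑ w : Fin n → σ, density V (List.ofFn w)) / (Fintype.card σ : ℝ) ^ n

/-- `homCount V W` counts the encounters of `V` in `W`: triples `(a, b, φ)`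
where `φ` is a nonerasing homomorphism from the letters of `V` with
`W[a,b] = φ(V)`. -/
noncomputable def homCount {α σ : Type*} (V : List α) (W : List σ) : ℕ :=
  Set.ncard {t : ℕ × ℕ × ({a : α // a ∈ V} → List σ) |
    t.1 < t.2.1 ∧ t.2.1 ≤ W.length ∧ (∀ a, t.2.2 a ≠ []) ∧
    subword W t.1 t.2.1 = (V.attach.map t.2.2).flatten}

/-- Expected number of encounters of `V` in a uniformly random word of length `n`. -/
noncomputable def expHom {α : Type*} (V : List α) (σ : Type*) [Fintype σ] (n : ℕ) : ℝ :=
  (∑ w : Fin n → σ, (homCount V (List.ofFn w) : ℝ)) / (Fintype.card σ : ℝ) ^ n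

/-- `instProb V σ m` is the proportion of words in `σ^m` that are instances of `V`. -/
noncomputable def instProb {α : Type*} (V : List α) (σ : Type*) [Fintype σ] (m : ℕ) : ℝ :=
  (Nat.card {w : Fin m → σ // IsInstance V (List.ofFn w)} : ℝ) / (Fintype.card σ : ℝ) ^ m

/-- The variance of the density of `V` in a uniformly random word of length `n`. -/
noncomputable def varDensity {α : Type*} (V : List α) (σ : Type*) [Fintype σ] (n : ℕ) : ℝ :=
  (∑ w : Fin n → σ, (density V (List.ofFn w) - expDensity V σ n) ^ 2) /
    (Fintype.card σ : ℝ) ^ n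

theorem subword_congr {σ : Type*} {n : ℕ} (w w' : Fin n → σ) (i j : ℕ)
    (h : ∀ x : Fin n, i ≤ x → (x : ℕ) < j → w x = w' x) :
    subword (List.ofFn w) i j = subword (List.ofFn w') i j := by
  unfold subword
  apply List.ext_getElem
  · simp
  · intro k h1 h2
    simp only [List.getElem_take, List.getElem_drop, List.getElem_ofFn]
    simp at h1
    apply h
    · simp
    · simp; omega

open Classical in
/-- Indicator that the substring at `s` is an instance. -/
noncomputable def ind {α σ : Type*} (V : List α) {n : ℕ} (s : ℕ × ℕ) (w : Fin n → σ) : ℝ :=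
  if IsInstance V (subword (List.ofFn w) s.1 s.2) then 1 else 0

/-- The index set of the substrings. -/
def prs (n : ℕ) : Finset (ℕ × ℕ) :=
  (Finset.range (n + 1) ×ˢ Finset.range (n + 1)).filter (fun p => p.1 < p.2)

theorem density_eq {α σ : Type*} (V : List α) {n : ℕ} (w : Fin n → σ) :
    density V (List.ofFn w) = (∑ s ∈ prs n, ind V s w) / (Nat.choose (n + 1) 2) := by
  unfold density ind prs
  rw [Finset.sum_boole, Finset.filter_filter]
  simp

theorem ind_nonneg {α σ : Type*} (V : List α) {n : ℕ} (s : ℕ × ℕ) (w : Fin n → σ) :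
    0 ≤ ind V s w := by
  unfold ind; split_ifs <;> simp

theorem ind_le_one {α σ : Type*} (V : List α) {n : ℕ} (s : ℕ × ℕ) (w : Fin n → σ) :
    ind V s w ≤ 1 := by
  unfold ind; split_ifs <;> simp

/-- Swap of the coordinates outside `S`. -/
def swapOff {n : ℕ} {σ : Type*} (S : Fin n → Prop) [DecidablePred S] :
    ((Fin n → σ) × (Fin n → σ)) ≃ ((Fin n → σ) × (Fin n → σ)) where
  toFun p := (fun x => if S x then p.1 x else p.2 x, fun x => if S x then p.2 x else p.1 x)
  invFun p := (fun x => if S x then p.1 x else p.2 x, fun x => if S x then p.2 x else p.1 x)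
  left_inv p := by
    ext x <;> by_cases h : S x <;> simp [h]
  right_inv p := by
    ext x <;> by_cases h : S x <;> simp [h]

theorem indep {n : ℕ} {σ : Type*} [Fintype σ] (S : Fin n → Prop) [DecidablePred S]
    (f g : (Fin n → σ) → ℝ)
    (hf : ∀ w w', (∀ x, S x → w x = w' x) → f w = f w')
    (hg : ∀ w w', (∀ x, ¬ S x → w x = w' x) → g w = g w') :
    (∑ w, f w * g w) * (Fintype.card σ : ℝ) ^ n = (∑ w, f w) * (∑ w, g w) := by
  have h1 : (∑ w, f w * g w) * (Fintype.card σ : ℝ) ^ n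
      = ∑ p : (Fin n → σ) × (Fin n → σ), f p.1 * g p.1 := by
    rw [Fintype.sum_prod_type]
    simp only [Finset.sum_const, Finset.card_univ, nsmul_eq_mul, Finset.sum_mul]
    apply Finset.sum_congr rfl
    intro w _
    simp [mul_comm]
  rw [h1, Finset.sum_mul_sum, ← Fintype.sum_prod_type' (fun a b => f a * g b),
    ← Equiv.sum_comp (swapOff S)]
  apply Finset.sum_congr rfl
  rintro ⟨a, b⟩ -
  simp only [swapOff, Equiv.coe_fn_mk]
  rw [hf _ a, hg _ b]
  · intro x hx; simp [hx]
  · intro x hx; simp [hx]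

theorem ind_congr {α σ : Type*} (V : List α) {n : ℕ} (s : ℕ × ℕ) (w w' : Fin n → σ)
    (h : ∀ x : Fin n, s.1 ≤ x → (x : ℕ) < s.2 → w x = w' x) : ind V s w = ind V s w' := by
  unfold ind
  rw [subword_congr w w' _ _ h]

theorem ind_indep {α σ : Type*} [Fintype σ] (V : List α) (n : ℕ) (s t : ℕ × ℕ)
    (h : s.2 ≤ t.1 ∨ t.2 ≤ s.1) :
    (∑ w : Fin n → σ, ind V s w * ind V t w) * (Fintype.card σ : ℝ) ^ n
      = (∑ w : Fin n → σ, ind V s w) * (∑ w : Fin n → σ, ind V t w) := by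
  apply indep (fun x : Fin n => s.1 ≤ x ∧ (x : ℕ) < s.2)
  · intro w w' hw
    exact ind_congr V s w w' (fun x h1 h2 => hw x ⟨h1, h2⟩)
  · intro w w' hw
    exact ind_congr V t w w' (fun x h1 h2 => hw x (by omega))

theorem var_abs {ι Ω : Type*} [Fintype Ω] (P : Finset ι) (I : ι → Ω → ℝ) (N C : ℝ)
    (hN : N = Fintype.card Ω) (hN0 : 0 < N) :
    (∑ w, ((∑ s ∈ P, I s w) / C - (∑ w, (∑ s ∈ P, I s w) / C) / N) ^ 2) / N
      = (∑ s ∈ P, ∑ t ∈ P,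
          ((∑ w, I s w * I t w) / N - (∑ w, I s w) * (∑ w, I t w) / N ^ 2)) / C ^ 2 := by
  have e1 : ∑ s ∈ P, ∑ t ∈ P,
          ((∑ w, I s w * I t w) / N - (∑ w, I s w) * (∑ w, I t w) / N ^ 2)
      = (∑ w, (∑ s ∈ P, I s w) ^ 2) / N - (∑ w, ∑ s ∈ P, I s w) ^ 2 / N ^ 2 := by
    simp only [Finset.sum_sub_distrib, ← Finset.sum_div]
    congr 2
    · simp only [sq, Finset.sum_mul_sum]
      rw [Finset.sum_comm (s := Finset.univ)]
      apply Finset.sum_congr rfl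
      intro i _
      rw [Finset.sum_comm]
    · rw [Finset.sum_comm (s := Finset.univ), sq, Finset.sum_mul_sum]
  rw [e1]
  set X : Ω → ℝ := fun w => ∑ s ∈ P, I s w with hX
  have e2 : ∀ w, (X w / C - (∑ w, X w / C) / N) ^ 2
      = (X w ^ 2 - 2 * ((∑ w, X w) / N) * X w + ((∑ w, X w) / N) ^ 2) / C ^ 2 := by
    intro w
    rw [← Finset.sum_div]
    by_cases hC : C = 0
    · simp [hC]
    · field_simp
      ring
  change (∑ w, (X w / C - (∑ w, X w / C) / N) ^ 2) / N = _
  simp_rw [e2]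
  rw [← Finset.sum_div, Finset.sum_add_distrib, Finset.sum_sub_distrib, ← Finset.mul_sum]
  simp only [Finset.sum_const, Finset.card_univ, nsmul_eq_mul, ← hN]
  by_cases hC : C = 0
  · simp [hC]
  · field_simp
    ring

/-- Codes for instances of length `m`. -/
abbrev Code {α : Type*} [DecidableEq α] (V : List α) (σ : Type*) (m : ℕ) :=
  Σ l : {l : {a // a ∈ V} → Fin (m + 1) // 2 * ∑ a, (l a : ℕ) ≤ m},
    ∀ a : {a // a ∈ V}, Fin (l.1 a) → σ

/-- The instance with a given code. -/
def decode {α : Type*} [DecidableEq α] {V : List α} {σ : Type*} {m : ℕ} (t : Code V σ m) :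
    List σ := (V.attach.map (fun a => List.ofFn (t.2 a))).flatten

theorem decode_surj {α : Type*} [DecidableEq α] {V : List α} {σ : Type*} (hdbl : Doubled V)
    {W : List σ} (h : IsInstance V W) : ∃ t : Code V σ W.length, decode t = W := by
  obtain ⟨φ, -, hW⟩ := h
  have hlen : W.length = ∑ a ∈ V.toFinset, V.count a * (φ a).length := by
    have := Finset.sum_list_map_count V (fun a => (φ a).length)
    simp only [smul_eq_mul] at this
    rw [← this, hW, List.length_flatten, List.map_map]
    rfl
  have hs : 2 * ∑ a : {a // a ∈ V}, (φ a).length ≤ W.length := by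
    rw [hlen, ← Finset.sum_subtype V.toFinset (by simp) (fun a => (φ a).length), Finset.mul_sum]
    apply Finset.sum_le_sum
    intro a ha
    exact Nat.mul_le_mul_right _ (hdbl a (by simpa using ha))
  have hle : ∀ a : {a // a ∈ V}, (φ a).length ≤ W.length := by
    intro a
    have := Finset.single_le_sum (f := fun a : {a // a ∈ V} => (φ a).length)
      (fun _ _ => Nat.zero_le _) (Finset.mem_univ a)
    omega
  refine ⟨⟨⟨fun a => ⟨(φ a).length, by have := hle a; omega⟩, hs⟩, fun a => (φ a).get⟩, ?_⟩
  unfold decode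
  simp only [List.ofFn_get]
  conv_rhs => rw [hW, ← List.attach_map_subtype_val V]
  rw [List.map_map]
  simp [Function.comp_def]

theorem card_code {α : Type*} [DecidableEq α] (V : List α) (σ : Type*) [Fintype σ]
    (hq : 2 ≤ Fintype.card σ) (m : ℕ) :
    (Fintype.card (Code V σ m) : ℝ) ≤
      ((m : ℝ) + 1) ^ (Fintype.card {a // a ∈ V}) * (Real.sqrt (Fintype.card σ)) ^ m := by
  have hq1 : (1 : ℝ) ≤ Real.sqrt (Fintype.card σ) := by
    rw [Real.one_le_sqrt]; exact_mod_cast (by omega : 1 ≤ Fintype.card σ)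
  have hsq : (Fintype.card σ : ℝ) = Real.sqrt (Fintype.card σ) ^ 2 := by
    rw [Real.sq_sqrt]; positivity
  rw [Fintype.card_sigma]
  push_cast
  simp only [Fintype.card_pi, Finset.prod_const, Finset.card_univ, Fintype.card_fin]
  push_cast
  have : ∀ l : {l : {a // a ∈ V} → Fin (m + 1) // 2 * ∑ a, (l a : ℕ) ≤ m},
      ∏ a, (Fintype.card σ : ℝ) ^ (l.1 a : ℕ) ≤ (Real.sqrt (Fintype.card σ)) ^ m := by
    intro l
    rw [Finset.prod_pow_eq_pow_sum]
    conv_lhs => rw [hsq]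
    rw [← pow_mul]
    exact pow_le_pow_right₀ hq1 l.2
  refine (Finset.sum_le_sum (fun l _ => this l)).trans ?_
  rw [Finset.sum_const, nsmul_eq_mul]
  gcongr
  have h2 := Fintype.card_subtype_le (fun l : {a // a ∈ V} → Fin (m + 1) => 2 * ∑ a, (l a : ℕ) ≤ m)
  rw [Fintype.card_fun, Fintype.card_fin] at h2
  rw [Finset.card_univ]
  exact_mod_cast h2

theorem ind_sum_le {α : Type*} [DecidableEq α] (V : List α) (σ : Type*) [Fintype σ]
    (hdbl : Doubled V) (n i m : ℕ) (h : i + m ≤ n) :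
    (∑ w : Fin n → σ, ind V (i, i + m) w) ≤
      Fintype.card (Code V σ m) * (Fintype.card σ : ℝ) ^ (n - m) := by
  classical
  unfold ind
  rw [Finset.sum_boole]
  have : (Finset.univ.filter (fun w : Fin n → σ =>
      IsInstance V (subword (List.ofFn w) i (i + m)))).card ≤
      Fintype.card (Code V σ m × (Fin (n - m) → σ)) := by
    rw [← Finset.card_image_of_injective _ (List.ofFn_injective (n := n) (α := σ)),
      ← Finset.card_univ]
    refine (Finset.card_le_card ?_).trans (Finset.card_image_le (f := fun p :
      Code V σ m × (Fin (n - m) → σ) =>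
        (List.ofFn p.2).take i ++ decode p.1 ++ (List.ofFn p.2).drop i))
    intro L hL
    simp only [Finset.mem_image, Finset.mem_filter, Finset.mem_univ, true_and] at hL ⊢
    obtain ⟨w, hw, rfl⟩ := hL
    set L := List.ofFn w with hLdef
    have hL : L.length = n := by simp [L]
    have hlen : (subword L i (i + m)).length = m := by
      simp [subword, hL]; omega
    obtain ⟨t, ht⟩ : ∃ t : Code V σ m, decode t = subword L i (i + m) := by
      have := decode_surj hdbl hw
      rwa [hlen] at this
    have hR : (L.take i ++ L.drop (i + m)).length = n - m := by
      simp [hL]; omega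
    refine ⟨(t, fun x => (L.take i ++ L.drop (i + m)).get (x.cast hR.symm)), ?_⟩
    have hof : List.ofFn (fun x : Fin (n - m) => (L.take i ++ L.drop (i + m)).get (x.cast hR.symm))
        = L.take i ++ L.drop (i + m) := by
      apply List.ext_getElem
      · simp [hL]; omega
      · intro k h1 h2
        simp
    simp only [hof, ht]
    have hi : (L.take i).length = i := by simp [hL]; omega
    rw [List.take_left' hi, List.drop_left' hi]
    simp only [subword, Nat.add_sub_cancel_left, List.append_assoc]
    rw [← List.drop_drop, List.take_append_drop, List.take_append_drop]
  rw [Fintype.card_prod, Fintype.card_fun, Fintype.card_fin] at this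
  exact_mod_cast this

/-- Bound for the probability. -/
noncomputable def bnd (k q : ℕ) (m : ℕ) : ℝ := ((m : ℝ) + 1) ^ k * ((Real.sqrt q)⁻¹) ^ m

theorem bnd_nonneg (k q m : ℕ) : 0 ≤ bnd k q m := by unfold bnd; positivity

theorem prob_le {α : Type*} [DecidableEq α] (V : List α) (σ : Type*) [Fintype σ]
    (hdbl : Doubled V) (hq : 2 ≤ Fintype.card σ) (n : ℕ) (s : ℕ × ℕ) (hs : s ∈ prs n) :
    (∑ w : Fin n → σ, ind V s w) / (Fintype.card σ : ℝ) ^ n ≤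
      bnd (Fintype.card {a // a ∈ V}) (Fintype.card σ) (s.2 - s.1) := by
  obtain ⟨i, j⟩ := s
  simp only [prs, Finset.mem_filter, Finset.mem_product, Finset.mem_range] at hs
  obtain ⟨m, rfl⟩ := Nat.exists_eq_add_of_le hs.2.le
  simp only [Nat.add_sub_cancel_left]
  have hq0 : (0 : ℝ) < Fintype.card σ := by exact_mod_cast (by omega : 0 < Fintype.card σ)
  rw [div_le_iff₀ (by positivity)]
  refine (ind_sum_le V σ hdbl n i m (by omega)).trans ?_
  refine (mul_le_mul_of_nonneg_right (card_code V σ hq m) (by positivity)).trans ?_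
  have hn : (Fintype.card σ : ℝ) ^ n
      = Real.sqrt (Fintype.card σ) ^ m * Real.sqrt (Fintype.card σ) ^ m
        * (Fintype.card σ : ℝ) ^ (n - m) := by
    rw [← mul_pow, Real.mul_self_sqrt hq0.le, ← pow_add]
    congr 1; omega
  unfold bnd
  rw [hn]
  have : 0 < Real.sqrt (Fintype.card σ) := Real.sqrt_pos.2 hq0
  apply le_of_eq
  rw [inv_pow]
  field_simp

theorem bnd_summable (k q : ℕ) (hq : 2 ≤ q) :
    Summable (fun m : ℕ => ((m : ℝ) + 1) ^ 2 * bnd k q m) := by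
  have hr : ‖(Real.sqrt q)⁻¹‖ < 1 := by
    rw [Real.norm_of_nonneg (by positivity)]
    apply inv_lt_one_of_one_lt₀
    rw [Real.lt_sqrt (by norm_num)]
    have : (2 : ℝ) ≤ q := by exact_mod_cast hq
    linarith
  have h0 := summable_pow_mul_geometric_of_norm_lt_one (k + 2) hr
  have h1 := (summable_nat_add_iff 1).2 h0
  have h2 := h1.mul_left (Real.sqrt q)
  refine h2.congr ?_
  intro m
  have : 0 < Real.sqrt q := Real.sqrt_pos.2 (by exact_mod_cast (by omega : 0 < q))
  unfold bnd
  push_cast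
  rw [inv_pow, inv_pow, pow_succ (Real.sqrt q)]
  field_simp
  ring
/-- `t` overlaps `s` and is not longer. -/
abbrev Ov (s t : ℕ × ℕ) : Prop :=
  ¬ (s.2 ≤ t.1 ∨ t.2 ≤ s.1) ∧ t.2 - t.1 ≤ s.2 - s.1

theorem card_ov (n : ℕ) (s : ℕ × ℕ) (hs : s ∈ prs n) :
    (((prs n).filter (fun t => Ov s t)).card : ℝ) ≤ 4 * (((s.2 - s.1 : ℕ) : ℝ) + 1) ^ 2 := by
  have hsub : (prs n).filter (fun t => Ov s t) ⊆
      Finset.Icc (s.1 - (s.2 - s.1)) (s.1 + (s.2 - s.1)) ×ˢ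
        Finset.Icc s.1 (s.1 + 2 * (s.2 - s.1)) := by
    intro t ht
    simp only [prs, Ov, Finset.mem_filter, Finset.mem_product, Finset.mem_range,
      Finset.mem_Icc] at hs ht ⊢
    omega
  have h1 := Finset.card_le_card hsub
  rw [Finset.card_product, Nat.card_Icc, Nat.card_Icc] at h1
  have h2 : s.1 + (s.2 - s.1) + 1 - (s.1 - (s.2 - s.1)) ≤ 2 * ((s.2 - s.1) + 1) := by omega
  have h3 : s.1 + 2 * (s.2 - s.1) + 1 - s.1 ≤ 2 * ((s.2 - s.1) + 1) := by omega
  have h4 := h1.trans (Nat.mul_le_mul h2 h3)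
  have h5 : (((prs n).filter (fun t => Ov s t)).card : ℝ) ≤
    ((2 * ((s.2 - s.1) + 1) * (2 * ((s.2 - s.1) + 1)) : ℕ) : ℝ) := by exact_mod_cast h4
  refine h5.trans (le_of_eq ?_)
  push_cast
  ring

theorem sum_ov (n : ℕ) (b : ℕ → ℝ) (hb : ∀ m, 0 ≤ b m)
    (hs : Summable (fun m : ℕ => ((m : ℝ) + 1) ^ 2 * b m)) :
    ∑ s ∈ prs n, ∑ t ∈ prs n, (if Ov s t then b (s.2 - s.1) else 0)
      ≤ (n + 1) * (4 * ∑' m : ℕ, ((m : ℝ) + 1) ^ 2 * b m) := by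
  set g : ℕ → ℝ := fun m => ((m : ℝ) + 1) ^ 2 * b m with hg
  have hg0 : ∀ m, 0 ≤ g m := fun m => mul_nonneg (by positivity) (hb m)
  have h1 : ∑ s ∈ prs n, ∑ t ∈ prs n, (if Ov s t then b (s.2 - s.1) else 0)
      ≤ ∑ s ∈ prs n, 4 * g (s.2 - s.1) := by
    apply Finset.sum_le_sum
    intro s hs
    rw [← Finset.sum_filter, Finset.sum_const, nsmul_eq_mul]
    refine (mul_le_mul_of_nonneg_right (card_ov n s hs) (hb _)).trans (le_of_eq ?_)
    simp only [hg]; ring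
  refine h1.trans ?_
  rw [prs, Finset.sum_filter, Finset.sum_product]
  refine (Finset.sum_le_sum (g := fun _ => 4 * ∑' m, g m) ?_).trans ?_
  · intro i _
    rw [← Finset.sum_filter]
    simp only [← Finset.mul_sum]
    apply mul_le_mul_of_nonneg_left _ (by norm_num)
    rw [← Finset.sum_image (f := g) (g := fun j => j - i)]
    · exact hs.sum_le_tsum _ (fun m _ => hg0 m)
    · intro x hx y hy hxy
      simp at hx hy hxy
      omega
  · simp

theorem cov_le {α : Type*} [DecidableEq α] (V : List α) (σ : Type*) [Fintype σ]
    (hdbl : Doubled V) (hq : 2 ≤ Fintype.card σ) (n : ℕ) (s t : ℕ × ℕ) (hs : s ∈ prs n)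
    (ht : t ∈ prs n) (b : ℕ → ℝ)
    (hb : b = bnd (Fintype.card {a // a ∈ V}) (Fintype.card σ)) :
    (∑ w : Fin n → σ, ind V s w * ind V t w) / (Fintype.card σ : ℝ) ^ n
      - (∑ w : Fin n → σ, ind V s w) * (∑ w : Fin n → σ, ind V t w)
        / ((Fintype.card σ : ℝ) ^ n) ^ 2 ≤
      (if Ov s t then b (s.2 - s.1) else 0) + (if Ov t s then b (t.2 - t.1) else 0) := by
  have hq0 : (0 : ℝ) < Fintype.card σ := by exact_mod_cast (by omega : 0 < Fintype.card σ)
  have hb0 : ∀ m, 0 ≤ b m := fun m => hb ▸ bnd_nonneg _ _ m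
  have hN : 0 < (Fintype.card σ : ℝ) ^ n := by positivity
  have hF : ∀ s t : ℕ × ℕ, 0 ≤ (if Ov s t then b (s.2 - s.1) else 0) := by
    intro s t; split_ifs
    · exact hb0 _
    · exact le_rfl
  by_cases h : s.2 ≤ t.1 ∨ t.2 ≤ s.1
  · rw [← ind_indep V n s t h]
    refine le_trans (le_of_eq ?_) (add_nonneg (hF s t) (hF t s))
    field_simp
    ring
  · have hnn : 0 ≤ (∑ w : Fin n → σ, ind V s w) * (∑ w : Fin n → σ, ind V t w)
        / ((Fintype.card σ : ℝ) ^ n) ^ 2 :=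
      div_nonneg (mul_nonneg (Finset.sum_nonneg fun w _ => ind_nonneg V s w)
        (Finset.sum_nonneg fun w _ => ind_nonneg V t w)) (by positivity)
    refine (sub_le_self _ hnn).trans ?_
    rcases le_total (t.2 - t.1) (s.2 - s.1) with hl | hl
    · have ho : Ov s t := ⟨h, hl⟩
      refine le_trans ?_ (le_add_of_nonneg_right (hF t s))
      rw [if_pos ho, hb]
      refine le_trans ?_ (prob_le V σ hdbl hq n s hs)
      gcongr with w
      exact mul_le_of_le_one_right (ind_nonneg V s w) (ind_le_one V t w)
    · have ho : Ov t s := ⟨by omega, hl⟩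
      refine le_trans ?_ (le_add_of_nonneg_left (hF s t))
      rw [if_pos ho, hb]
      refine le_trans ?_ (prob_le V σ hdbl hq n t ht)
      gcongr with w
      exact mul_le_of_le_one_left (ind_nonneg V t w) (ind_le_one V s w)

theorem choose_real (n : ℕ) : ((Nat.choose (n + 1) 2 : ℕ) : ℝ) = (n + 1) * n / 2 := by
  rw [Nat.cast_choose_two]; push_cast; ring

theorem var_le {α : Type*} [DecidableEq α] (V : List α) (σ : Type*) [Fintype σ]
    (hdbl : Doubled V) (hq : 2 ≤ Fintype.card σ) :
    ∃ K : ℝ, 0 ≤ K ∧ ∀ n : ℕ, 1 ≤ n → varDensity V σ n ≤ K / (n : ℝ) ^ 3 := by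
  set b := bnd (Fintype.card {a // a ∈ V}) (Fintype.card σ) with hb
  have hb0 : ∀ m, 0 ≤ b m := fun m => bnd_nonneg _ _ m
  have hsum := bnd_summable (Fintype.card {a // a ∈ V}) (Fintype.card σ) hq
  set S := ∑' m : ℕ, ((m : ℝ) + 1) ^ 2 * b m with hS
  have hS0 : 0 ≤ S := tsum_nonneg fun m => mul_nonneg (by positivity) (hb0 m)
  refine ⟨32 * S, by positivity, ?_⟩
  intro n hn
  have hq0 : (0 : ℝ) < Fintype.card σ := by exact_mod_cast (by omega : 0 < Fintype.card σ)
  have hn0 : (0 : ℝ) < n := by exact_mod_cast hn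
  unfold varDensity expDensity
  simp only [density_eq]
  rw [var_abs (prs n) (fun s w => ind V s w) _ _ (by simp) (by positivity)]
  have h1 := Finset.sum_le_sum (fun s hs => Finset.sum_le_sum (fun t ht =>
    cov_le V σ hdbl hq n s t hs ht b hb)) (s := prs n)
  have h2 : ∑ s ∈ prs n, ∑ t ∈ prs n, ((if Ov s t then b (s.2 - s.1) else 0)
      + (if Ov t s then b (t.2 - t.1) else 0)) ≤ 2 * ((n + 1) * (4 * S)) := by
    simp only [Finset.sum_add_distrib]
    rw [Finset.sum_comm (f := fun s t => if Ov t s then b (t.2 - t.1) else 0)]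
    have := sum_ov n b hb0 hsum
    linarith
  refine (div_le_div_of_nonneg_right (h1.trans h2) (by positivity)).trans ?_
  rw [choose_real, div_le_div_iff₀ (by positivity) (by positivity)]
  have : 0 ≤ S * n ^ 2 * (n + 1) := by positivity
  nlinarith

theorem exp_ge {α : Type*} (V : List α) (σ : Type*) [Fintype σ]
    (hV : V ≠ []) (hq : 2 ≤ Fintype.card σ) :
    ∃ c : ℝ, 0 < c ∧ ∀ n : ℕ, 2 * V.length ≤ n → c / n ≤ expDensity V σ n := by
  classical
  have hq0 : (0 : ℝ) < Fintype.card σ := by exact_mod_cast (by omega : 0 < Fintype.card σ)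
  have hL : 0 < V.length := List.length_pos_iff.2 hV
  obtain ⟨a0⟩ : Nonempty σ := Fintype.card_pos_iff.1 (by omega)
  refine ⟨((Fintype.card σ : ℝ) ^ V.length)⁻¹ / 2, by positivity, ?_⟩
  intro n hn
  have hn0 : (0 : ℝ) < n := by exact_mod_cast (by omega : 0 < n)
  set N := (Fintype.card σ : ℝ) ^ n with hN
  set Q := (Fintype.card σ : ℝ) ^ V.length with hQ
  have hQ0 : 0 < Q := by positivity
  have hN0 : 0 < N := by positivity
  have key : ∀ i ∈ Finset.range (n - V.length),
      N / Q ≤ ∑ w : Fin n → σ, ind V (i, i + V.length) w := by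
    intro i hi
    rw [Finset.mem_range] at hi
    set A : Fin n → Finset σ := fun x =>
      if i ≤ (x : ℕ) ∧ (x : ℕ) < i + V.length then {a0} else Finset.univ with hA
    have hsub : ∀ w ∈ Fintype.piFinset A, ind V (i, i + V.length) w = 1 := by
      intro w hw
      rw [Fintype.mem_piFinset] at hw
      unfold ind
      rw [if_pos]
      refine ⟨fun _ => [a0], by simp, ?_⟩
      have : (V.map (fun _ => [a0])).flatten = List.replicate V.length a0 := by
        clear * -
        induction V with
        | nil => rfl
        | cons x V ih => simp [List.replicate_succ]
      rw [this]
      apply List.ext_getElem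
      · simp [subword]; omega
      · intro k h1 h2
        simp at h2
        simp only [subword, List.getElem_take, List.getElem_drop, List.getElem_ofFn,
          List.getElem_replicate]
        have := hw ⟨i + k, by omega⟩
        simp only [hA] at this
        rw [if_pos (by omega)] at this
        simpa using this
    have h1 : ((Fintype.piFinset A).card : ℝ) ≤ ∑ w : Fin n → σ, ind V (i, i + V.length) w := by
      have : ((Fintype.piFinset A).card : ℝ)
          = ∑ w ∈ Fintype.piFinset A, ind V (i, i + V.length) w := by
        rw [Finset.sum_congr rfl hsub]; simp
      rw [this]
      exact Finset.sum_le_sum_of_subset_of_nonneg (Finset.subset_univ _)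
        (fun w _ _ => ind_nonneg V _ w)
    refine le_trans ?_ h1
    rw [Fintype.card_piFinset]
    have h2 : ∀ x, (A x).card = if i ≤ (x : ℕ) ∧ (x : ℕ) < i + V.length then 1
        else Fintype.card σ := by
      intro x; simp only [hA]; split_ifs <;> simp
    simp only [h2]
    rw [Finset.prod_ite, Finset.prod_const_one, one_mul, Finset.prod_const]
    rw [div_le_iff₀ hQ0]
    push_cast
    rw [hN, hQ, ← pow_add]
    apply pow_le_pow_right₀
    · exact_mod_cast (by omega : 1 ≤ Fintype.card σ)
    · have h3 := Finset.card_filter_add_card_filter_not (s := (Finset.univ : Finset (Fin n)))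
        (fun x : Fin n => i ≤ (x : ℕ) ∧ (x : ℕ) < i + V.length)
      rw [Finset.card_univ, Fintype.card_fin] at h3
      have h4 : (Finset.univ.filter
          (fun x : Fin n => i ≤ (x : ℕ) ∧ (x : ℕ) < i + V.length)).card ≤ V.length := by
        rw [← Finset.card_map Fin.valEmbedding]
        refine (Finset.card_le_card (t := Finset.Ico i (i + V.length)) ?_).trans (by simp)
        intro y hy
        simp only [Finset.mem_map, Finset.mem_filter, Fin.valEmbedding_apply] at hy
        obtain ⟨x, hx, rfl⟩ := hy
        simp only [Finset.mem_Ico]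
        exact hx.2
      omega
  have hsum : (n - V.length : ℕ) * (N / Q) ≤ ∑ w : Fin n → σ, ∑ s ∈ prs n, ind V s w := by
    have h1 := Finset.sum_le_sum key
    rw [Finset.sum_const, Finset.card_range, nsmul_eq_mul] at h1
    refine h1.trans ?_
    rw [Finset.sum_comm]
    apply Finset.sum_le_sum
    intro w _
    rw [← Finset.sum_image (f := fun s => ind V s w) (g := fun i => (i, i + V.length))]
    · apply Finset.sum_le_sum_of_subset_of_nonneg
      · intro s hs
        simp only [Finset.mem_image, Finset.mem_range] at hs
        obtain ⟨i, hi, rfl⟩ := hs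
        simp only [prs, Finset.mem_filter, Finset.mem_product, Finset.mem_range]
        omega
      · intro s _ _
        exact ind_nonneg V s w
    · intro x _ y _ hxy
      simpa using congrArg Prod.fst hxy
  unfold expDensity
  simp only [density_eq]
  rw [← Finset.sum_div, choose_real]
  have hh : (n : ℝ) / 2 ≤ (n - V.length : ℕ) := by
    rw [Nat.cast_sub (by omega)]
    have : (2 : ℝ) * V.length ≤ n := by exact_mod_cast hn
    linarith
  have h3 : (n : ℝ) / 2 * (N / Q) ≤ ∑ w : Fin n → σ, ∑ s ∈ prs n, ind V s w :=
    (mul_le_mul_of_nonneg_right hh (by positivity)).trans hsum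
  have h4 : Q⁻¹ / 2 / n ≤ (n : ℝ) / 2 * (N / Q) / ((n + 1) * n / 2) / N := by
    have hn1 : (1 : ℝ) ≤ n := by exact_mod_cast (by omega : 1 ≤ n)
    have : (n : ℝ) / 2 * (N / Q) / ((n + 1) * n / 2) / N = Q⁻¹ / (n + 1) := by field_simp
    rw [this, div_div]
    apply div_le_div_of_nonneg_left (by positivity) (by positivity)
    linarith
  refine h4.trans ?_
  gcongr

theorem var_nonneg {α : Type*} (V : List α) (σ : Type*) [Fintype σ] (n : ℕ) :
    0 ≤ varDensity V σ n := by
  unfold varDensity; positivity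

theorem var_nil {α : Type*} (σ : Type*) [Fintype σ] (n : ℕ) :
    varDensity ([] : List α) σ n = 0 := by
  have h : ∀ w : Fin n → σ, density ([] : List α) (List.ofFn w) = 0 := by
    intro w
    rw [density_eq, Finset.sum_eq_zero, zero_div]
    intro s hs
    simp only [prs, Finset.mem_filter, Finset.mem_product, Finset.mem_range] at hs
    unfold ind
    rw [if_neg]
    rintro ⟨φ, -, h⟩
    have := congrArg List.length h
    simp [subword] at this
    omega
  simp [varDensity, expDensity, h]

/-- For a doubled word `V` with `k` distinct letters and `|Σ| = q ≥ 2`,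
`Var(δ(V,W_n)) = O((log n)^3 / n^3)`; consequently
`Var(δ(V,W_n)) = O(E(δ(V,W_n))^2 (log n)^3 / n)`. -/
theorem stmt14 {α σ : Type*} [DecidableEq α] [Fintype σ] (V : List α)
    (hdbl : Doubled V) (hq : 2 ≤ Fintype.card σ) :
    (fun n : ℕ => varDensity V σ n) =O[atTop]
      (fun n : ℕ => (Real.log n) ^ 3 / (n : ℝ) ^ 3) ∧
    (fun n : ℕ => varDensity V σ n) =O[atTop]
      (fun n : ℕ => (expDensity V σ n) ^ 2 * (Real.log n) ^ 3 / n) := by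

  obtain ⟨K, hK, hvar⟩ := var_le V σ hdbl hq
  have hlog : ∀ n : ℕ, 3 ≤ n → 1 ≤ Real.log n ^ 3 := by
    intro n hn
    apply one_le_pow₀
    rw [Real.le_log_iff_exp_le (by exact_mod_cast (by omega : 0 < n))]
    have h3 : (3 : ℝ) ≤ n := by exact_mod_cast hn
    have := Real.exp_one_lt_d9
    linarith
  constructor
  · apply IsBigO.of_bound K
    filter_upwards [eventually_ge_atTop 3] with n hn
    have hn0 : (0 : ℝ) < n := by exact_mod_cast (by omega : 0 < n)
    have hl := hlog n hn
    rw [Real.norm_of_nonneg (var_nonneg V σ n), Real.norm_of_nonneg (by positivity)]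
    refine (hvar n (by omega)).trans ?_
    rw [mul_div_assoc']
    gcongr
    exact le_mul_of_one_le_right hK hl
  · by_cases hV : V = []
    · subst hV
      simp only [var_nil]
      exact isBigO_zero _ _
    obtain ⟨c, hc, hexp⟩ := exp_ge V σ hV hq
    apply IsBigO.of_bound (K / c ^ 2)
    filter_upwards [eventually_ge_atTop 3, eventually_ge_atTop (2 * V.length)] with n hn hn2
    have hn0 : (0 : ℝ) < n := by exact_mod_cast (by omega : 0 < n)
    have hl := hlog n hn
    rw [Real.norm_of_nonneg (var_nonneg V σ n), Real.norm_of_nonneg (by positivity)]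
    refine (hvar n (by omega)).trans ?_
    have h1 : (c / n) ^ 2 ≤ expDensity V σ n ^ 2 := by
      have := hexp n hn2
      gcongr
    have h2 : (c / n) ^ 2 * 1 ≤ expDensity V σ n ^ 2 * Real.log n ^ 3 := by gcongr
    calc K / (n : ℝ) ^ 3 = K / c ^ 2 * ((c / n) ^ 2 * 1 / n) := by field_simp
      _ ≤ _ := by gcongr
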